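/- If d and e are two-free base-3/2 digit strings such that v(d) − v(e) is an integer, then v(d) − v(e) ∈ {−1, 0, 1}; that is, no two values of two-free base-3/2 digit strings differ by an integer of absolute value greater than 1. -/

import Mathlib

/-- The value of a base-3/2 digit string. -/
def val32 (d : ℕ →₀ ℕ) : ℚ := d.sum fun i c => (c : ℚ) * (3 / 2 : ℚ) ^ i

/-- A digit string is two-free if all of its digits are 0 or 1. -/
def TwoFree (d : ℕ →₀ ℕ) : Prop := ∀ i, d i ≤ 1

/-- A sum of `n` integer multiples of powers of `3 / 2` becomes an integer after scaling
by `2 ^ n`. -/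
lemma exists_int_eq_two_pow_mul_sum (c : ℕ → ℤ) (n : ℕ) :
    ∃ k : ℤ, (2 : ℚ) ^ n * ∑ i ∈ Finset.range n, (c i : ℚ) * (3 / 2) ^ i = k := by
  induction n with
  | zero => exact ⟨0, by simp⟩
  | succ n ih =>
    obtain ⟨k, hk⟩ := ih
    refine ⟨2 * k + 2 * c n * 3 ^ n, ?_⟩
    have h : (2 : ℚ) ^ n * (3 / 2) ^ n = 3 ^ n := by
      rw [← mul_pow]
      norm_num
    rw [Finset.sum_range_succ]
    push_cast
    rw [← hk, ← h]
    ring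

/-- An integer with an expansion in base `3 / 2` with digits in `{-1, 0, 1}` is itself
in `{-1, 0, 1}`. -/
lemma abs_le_one_of_sum_eq_int (n : ℕ) (c : ℕ → ℤ) (hc : ∀ i, |c i| ≤ 1) (M : ℤ)
    (h : ∑ i ∈ Finset.range n, (c i : ℚ) * (3 / 2) ^ i = M) : |M| ≤ 1 := by
  induction n generalizing c M with
  | zero =>
    have : M = 0 := by simpa using h.symm
    simp [this]
  | succ n ih =>
    obtain ⟨k, hk⟩ := exists_int_eq_two_pow_mul_sum (fun i => c (i + 1)) n
    set S := ∑ i ∈ Finset.range n, (c (i + 1) : ℚ) * (3 / 2) ^ i with hS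
    have hM : 3 / 2 * S + c 0 = M := by
      rw [← h, Finset.sum_range_succ', hS, Finset.mul_sum]
      congr 1
      · exact Finset.sum_congr rfl fun i _ => by ring
      · simp
    have hdvd : (3 : ℤ) ∣ 2 ^ (n + 1) * (M - c 0) := by
      refine ⟨k, ?_⟩
      have : (2 : ℚ) ^ (n + 1) * (M - c 0) = 3 * k := by
        rw [← hk, ← hM]
        ring
      exact_mod_cast this
    obtain ⟨t, ht⟩ : (3 : ℤ) ∣ M - c 0 :=
      (IsCoprime.pow_right (by norm_num : IsCoprime (3 : ℤ) 2)).dvd_of_dvd_mul_left hdvd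
    have ht' : (M : ℚ) - c 0 = 3 * t := by exact_mod_cast ht
    have hbound := ih (fun i => c (i + 1)) (fun i => hc (i + 1)) (2 * t) (by
      rw [← hS]
      push_cast
      linarith)
    have h0 := hc 0
    rw [abs_le] at *
    omega

/-- The value of a digit string as a sum over an initial segment containing its support. -/
lemma val32_eq_sum_range (d : ℕ →₀ ℕ) (n : ℕ) (hn : d.support ⊆ Finset.range n) :
    val32 d = ∑ i ∈ Finset.range n, (d i : ℚ) * (3 / 2) ^ i :=
  Finsupp.sum_of_support_subset d hn _ (by simp)

/-- No two values of two-free base-3/2 digit strings differ by an integer of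
absolute value greater than 1. -/
theorem twoFree_integer_difference (d e : ℕ →₀ ℕ)
    (hd : TwoFree d) (he : TwoFree e)
    (M : ℤ) (h : val32 d - val32 e = M) :
    M = -1 ∨ M = 0 ∨ M = 1 := by
  obtain ⟨n, hn⟩ := (d.support ∪ e.support).exists_nat_subset_range
  rw [val32_eq_sum_range d n (Finset.union_subset_left hn),
    val32_eq_sum_range e n (Finset.union_subset_right hn), ← Finset.sum_sub_distrib] at h
  have hM := abs_le_one_of_sum_eq_int n (fun i => (d i : ℤ) - e i)
    (fun i => by
      have h1 := hd i
      have h2 := he i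
      rw [abs_le]
      omega) M (by
      rw [← h]
      exact Finset.sum_congr rfl fun i _ => by push_cast; ring)
  rw [abs_le] at hM
  omega
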